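/- arXiv:1711.10764 — 3 statements merged into one kernel-verified Lean document; each statement's English description precedes it below -/
import Mathlib

section
/- Let p be a prime and a,k integers with 1 ≤ a < p^k, and let (r_n) be the pattern sequence over F_p. Then for every N ≥ 1, (N − p^k + 1)/p ≤ L(r_n,N) ≤ ((p−1)N + p^k)/p. -/
/-- The N-th linear complexity of a sequence over a field: the least length `L` of a
linear recurrence satisfied by the first `N` terms of the sequence. -/
noncomputable def linearComplexity {F : Type*} [Field F] (u : ℕ → F) (N : ℕ) : ℕ :=
  sInf {L | ∃ c : Fin L → F, ∀ n, n + L < N → u (n + L) = ∑ i, c i * u (n + i)}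

theorem Prime.pow_mul_pow_sub_add_mul_pow_ne_zero {R : Type*} [CommRing R] [IsDomain R]
    [WfDvdMonoid R] {t x P Q : R} {p n : ℕ} (ht : Prime t) (hx : ¬ t ∣ x) (hQ : Q ≠ 0)
    (hp : 2 ≤ p) (hn : ¬ p ∣ n) :
    t ^ n * (P ^ p - P * Q ^ (p - 1)) + x * Q ^ p ≠ 0 := by
  intro h
  have hx0 : x ≠ 0 := fun h0 => hx (h0 ▸ dvd_zero t)
  have hn0 : n ≠ 0 := fun h0 => hn (h0 ▸ dvd_zero p)
  by_cases hP : P = 0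
  · rw [hP, zero_pow (by omega)] at h
    simp [hx0, hQ] at h
  obtain ⟨α, A, hA, rfl⟩ := WfDvdMonoid.max_power_factor hP ht.irreducible
  obtain ⟨β, B, hB, rfl⟩ := WfDvdMonoid.max_power_factor hQ ht.irreducible
  have hxB : ¬ t ∣ x * B ^ p := fun hd =>
    (ht.dvd_or_dvd hd).elim hx fun h' => hB (ht.dvd_of_dvd_pow h')
  obtain ⟨m, rfl⟩ : ∃ m, p = m + 1 := ⟨p - 1, by omega⟩
  rw [Nat.add_sub_cancel] at h
  rcases le_or_gt β α with hle | hlt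
  · obtain ⟨d, rfl⟩ := Nat.exists_eq_add_of_le hle
    have h1 : (t ^ β) ^ (m + 1) *
        (t ^ n * ((t ^ d * A) ^ (m + 1) - (t ^ d * A) * B ^ m) + x * B ^ (m + 1)) = 0 := by
      rw [← h]; ring
    have h2 := (mul_eq_zero.1 h1).resolve_left (pow_ne_zero _ (pow_ne_zero _ ht.ne_zero))
    refine hxB ((dvd_add_right ?_).1 (h2 ▸ dvd_zero t))
    exact (dvd_pow_self t hn0).mul_right _
  · obtain ⟨d, rfl⟩ := Nat.exists_eq_add_of_lt hlt
    have h1 : (t ^ α) ^ (m + 1) * (t ^ n * (A ^ (m + 1) - A * (t ^ (d + 1) * B) ^ m) +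
        t ^ ((m + 1) * (d + 1)) * (x * B ^ (m + 1))) = 0 := by
      rw [← h]; ring
    have h2 := (mul_eq_zero.1 h1).resolve_left (pow_ne_zero _ (pow_ne_zero _ ht.ne_zero))
    have hU : ¬ t ∣ A ^ (m + 1) - A * (t ^ (d + 1) * B) ^ m := fun hd => by
      refine hA (ht.dvd_of_dvd_pow ((dvd_sub_left ?_).1 hd))
      exact (dvd_pow (((dvd_pow_self t (by omega)).mul_right B)) (by omega)).mul_left A
    rcases lt_trichotomy n ((m + 1) * (d + 1)) with hl | he | hg
    · obtain ⟨e, he⟩ := Nat.exists_eq_add_of_lt hl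
      rw [he] at h2
      have h3 : t ^ n * ((A ^ (m + 1) - A * (t ^ (d + 1) * B) ^ m) +
          t * (t ^ e * (x * B ^ (m + 1)))) = 0 := by
        rw [← h2]; ring
      have h4 := (mul_eq_zero.1 h3).resolve_left (pow_ne_zero _ ht.ne_zero)
      exact hU ((dvd_add_left (dvd_mul_right _ _)).1 (h4 ▸ dvd_zero t))
    · exact hn ⟨_, he⟩
    · obtain ⟨e, he⟩ := Nat.exists_eq_add_of_lt hg
      rw [he] at h2
      have h3 : t ^ ((m + 1) * (d + 1)) * (t * (t ^ e * (A ^ (m + 1) -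
          A * (t ^ (d + 1) * B) ^ m)) + x * B ^ (m + 1)) = 0 := by
        rw [← h2]; ring
      have h4 := (mul_eq_zero.1 h3).resolve_left (pow_ne_zero _ ht.ne_zero)
      exact hxB ((dvd_add_right (dvd_mul_right _ _)).1 (h4 ▸ dvd_zero t))

section LinearComplexity

variable {F : Type*} [Field F] {u : ℕ → F}

/-- `C` is the reciprocal (connection) polynomial of a linear recurrence of length `l`
satisfied by the first `N` terms of `u`. -/
structure IsConnectionPolynomial (u : ℕ → F) (N l : ℕ) (C : Polynomial F) : Prop where
  coeff_zero : C.coeff 0 = 1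
  natDegree_le : C.natDegree ≤ l
  coeff_mul : ∀ n, l ≤ n → n < N → PowerSeries.coeff n ((C : PowerSeries F) * PowerSeries.mk u) = 0

theorem coeff_coe_mul_mk_add {C : Polynomial F} {l : ℕ} (hC : C.natDegree ≤ l) (n : ℕ) :
    PowerSeries.coeff (n + l) ((C : PowerSeries F) * PowerSeries.mk u) =
      C.coeff 0 * u (n + l) + ∑ i : Fin l, C.coeff (l - i) * u (n + i) := by
  rw [PowerSeries.coeff_mul, Finset.Nat.sum_antidiagonal_eq_sum_range_succ_mk]
  simp only [Polynomial.coeff_coe, PowerSeries.coeff_mk]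
  have hsub : Finset.range (l + 1) ⊆ Finset.range (n + l).succ :=
    Finset.range_subset_range.2 (by omega)
  rw [← Finset.sum_subset hsub fun j _ hj => by
    rw [Polynomial.coeff_eq_zero_of_natDegree_lt
      (hC.trans_lt (by simpa [Nat.lt_succ_iff] using hj)), zero_mul]]
  rw [Finset.sum_range_succ', add_comm, Nat.sub_zero, ← Finset.sum_range_reflect,
    Fin.sum_univ_eq_sum_range (fun i => C.coeff (l - i) * u (n + i))]
  congr 1
  refine Finset.sum_congr rfl fun j hj => ?_
  have := Finset.mem_range.1 hj
  congr 2 <;> omega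

theorem IsConnectionPolynomial.linearComplexity_le {N l : ℕ} {C : Polynomial F}
    (h : IsConnectionPolynomial u N l C) : linearComplexity u N ≤ l := by
  refine Nat.sInf_le ⟨fun i => -C.coeff (l - i), fun n hn => ?_⟩
  have := h.coeff_mul (n + l) (by omega) hn
  rw [coeff_coe_mul_mk_add h.natDegree_le, h.coeff_zero, one_mul] at this
  rw [eq_neg_of_add_eq_zero_left this, ← Finset.sum_neg_distrib]
  simp only [neg_mul]

theorem exists_isConnectionPolynomial (u : ℕ → F) (N : ℕ) :
    ∃ C, IsConnectionPolynomial u N (linearComplexity u N) C := by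
  obtain ⟨c, hc⟩ : linearComplexity u N ∈ {L | ∃ c : Fin L → F, ∀ n, n + L < N → u (n + L) = ∑ i, c i * u (n + i)} :=
    Nat.sInf_mem ⟨N, 0, fun n hn => by omega⟩
  generalize linearComplexity u N = l at c hc ⊢
  let C : Polynomial F := 1 - ∑ i : Fin l, Polynomial.monomial (l - i) (c i)
  have h0 : C.coeff 0 = 1 := by
    simp only [C, Polynomial.coeff_sub, Polynomial.coeff_one_zero, Polynomial.finsetSum_coeff]
    rw [Finset.sum_eq_zero fun i _ => Polynomial.coeff_monomial_of_ne _ (by omega), sub_zero]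
  have hi (i : Fin l) : C.coeff (l - i) = -c i := by
    simp only [C, Polynomial.coeff_sub, Polynomial.finsetSum_coeff, Polynomial.coeff_monomial,
      Polynomial.coeff_one]
    rw [if_neg (by omega), Finset.sum_eq_single i (fun j _ hj => if_neg ?_) (by simp)]
    · simp
    · have := Fin.val_ne_of_ne hj
      omega
  have hd : C.natDegree ≤ l := by
    refine (Polynomial.natDegree_sub_le _ _).trans (max_le (by simp) ?_)
    exact Polynomial.natDegree_sum_le_of_forall_le _ _ fun i _ =>
      (Polynomial.natDegree_monomial_le _).trans (by omega)
  refine ⟨C, h0, hd, fun n hln hn => ?_⟩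
  obtain ⟨n, rfl⟩ := Nat.exists_eq_add_of_le' hln
  rw [coeff_coe_mul_mk_add hd, h0, hc n hn]
  simp [hi]

theorem linearComplexity_zero (u : ℕ → F) : linearComplexity u 0 = 0 :=
  Nat.eq_zero_of_le_zero <| Nat.sInf_le ⟨0, fun _ hn => absurd hn (Nat.not_lt_zero _)⟩

theorem linearComplexity_le_self (u : ℕ → F) (N : ℕ) : linearComplexity u N ≤ N :=
  Nat.sInf_le ⟨0, fun _ hn => by omega⟩

/-- If a shortest recurrence for `N` terms extends to `N + 1` terms, the complexity does not
increase. -/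
theorem IsConnectionPolynomial.coeff_ne_zero {N : ℕ} {C : Polynomial F}
    (h : IsConnectionPolynomial u N (linearComplexity u N) C)
    (hlt : linearComplexity u N < linearComplexity u (N + 1)) :
    PowerSeries.coeff N ((C : PowerSeries F) * PowerSeries.mk u) ≠ 0 := fun h0 =>
  hlt.not_ge <| IsConnectionPolynomial.linearComplexity_le (C := C)
    ⟨h.coeff_zero, h.natDegree_le, fun n hln hn => by
      rcases Nat.lt_succ_iff_lt_or_eq.1 hn with hn | rfl
      exacts [h.coeff_mul n hln hn, h0]⟩

/-- The correction step of the Berlekamp–Massey algorithm. -/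
theorem IsConnectionPolynomial.linearComplexity_succ_le {N l m l' : ℕ} {C B : Polynomial F}
    (hC : IsConnectionPolynomial u N l C) (hB : IsConnectionPolynomial u m l' B) (hm : m < N)
    (hd : PowerSeries.coeff m ((B : PowerSeries F) * PowerSeries.mk u) ≠ 0) :
    linearComplexity u (N + 1) ≤ max l (N - m + l') := by
  set d := PowerSeries.coeff N ((C : PowerSeries F) * PowerSeries.mk u)
  set d' := PowerSeries.coeff m ((B : PowerSeries F) * PowerSeries.mk u) with hd'
  have hcoeff (n : ℕ) (hn : N - m ≤ n) : PowerSeries.coeff n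
      (((C - Polynomial.C (d / d') * (Polynomial.X ^ (N - m) * B) : Polynomial F) :
        PowerSeries F) * PowerSeries.mk u) =
      PowerSeries.coeff n ((C : PowerSeries F) * PowerSeries.mk u) -
        d / d' * PowerSeries.coeff (n - (N - m)) ((B : PowerSeries F) * PowerSeries.mk u) := by
    push_cast
    rw [sub_mul, mul_assoc, mul_assoc, map_sub, PowerSeries.coeff_C_mul,
      PowerSeries.coeff_X_pow_mul', if_pos hn]
  refine IsConnectionPolynomial.linearComplexity_le
    (C := C - Polynomial.C (d / d') * (Polynomial.X ^ (N - m) * B)) ⟨?_, ?_, fun n hln hn => ?_⟩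
  · rw [Polynomial.coeff_sub, Polynomial.coeff_C_mul, Polynomial.coeff_X_pow_mul',
      if_neg (by omega), hC.coeff_zero, mul_zero, sub_zero]
  · refine (Polynomial.natDegree_sub_le _ _).trans (max_le_max hC.natDegree_le ?_)
    refine (Polynomial.natDegree_C_mul_le _ _).trans (Polynomial.natDegree_mul_le.trans ?_)
    exact Nat.add_le_add (Polynomial.natDegree_X_pow_le _) hB.natDegree_le
  · rw [max_le_iff] at hln
    rw [hcoeff n (by omega)]
    rcases Nat.lt_succ_iff_lt_or_eq.1 hn with hn | rfl
    · rw [hC.coeff_mul n hln.1 hn, hB.coeff_mul _ (by omega) (by omega), mul_zero, sub_zero]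
    · rw [Nat.sub_sub_self hm.le, ← hd', div_mul_cancel₀ _ hd, sub_self]

/-- One direction of Massey's theorem on the jumps of the linear complexity profile. -/
theorem linearComplexity_succ_le (u : ℕ → F) (N : ℕ) :
    linearComplexity u (N + 1) ≤ max (linearComplexity u N) (N + 1 - linearComplexity u N) := by
  induction N using Nat.strong_induction_on with
  | _ N ih =>
  rcases Nat.eq_zero_or_pos (linearComplexity u N) with h0 | hpos
  · rw [h0]
    exact (linearComplexity_le_self u (N + 1)).trans (le_max_right _ _)
  have hex : ∃ j, j ≤ N ∧ linearComplexity u (N - j) < linearComplexity u N :=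
    ⟨N, le_rfl, by rwa [Nat.sub_self, linearComplexity_zero]⟩
  classical
  obtain ⟨hjN, hlt⟩ := Nat.find_spec hex
  set j := Nat.find hex with hj
  have hj0 : j ≠ 0 := fun h => by simp [h] at hlt
  have hge : linearComplexity u N ≤ linearComplexity u (N - j + 1) := by
    have := Nat.find_min hex (m := j - 1) (by omega)
    rw [show N - (j - 1) = N - j + 1 by omega] at this
    by_contra! hcon
    exact this ⟨by omega, hcon⟩
  rcases le_or_gt (linearComplexity u (N + 1)) (linearComplexity u N) with hle | hjump
  · exact hle.trans (le_max_left _ _)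
  obtain ⟨C, hC⟩ := exists_isConnectionPolynomial u N
  obtain ⟨B, hB⟩ := exists_isConnectionPolynomial u (N - j)
  have h1 := hC.linearComplexity_succ_le hB (by omega) (hB.coeff_ne_zero (hlt.trans_le hge))
  have h2 := ih (N - j) (by omega)
  omega

end LinearComplexity

section PatternSequence
open Polynomial

variable {p k a : ℕ} [Fact p.Prime] {r : ℕ → ZMod p}

theorem one_sub_X_pow_mul_mk_indicator (F : Type*) [CommRing F] {q a : ℕ} (haq : a < q) :
    (1 - PowerSeries.X ^ q) * PowerSeries.mk (fun n => if n % q = a then (1 : F) else 0) =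
      PowerSeries.X ^ a := by
  ext n
  rw [sub_mul, one_mul, map_sub, PowerSeries.coeff_X_pow_mul', PowerSeries.coeff_X_pow]
  simp only [PowerSeries.coeff_mk]
  rcases lt_or_ge n q with h | h
  · rw [if_neg (by omega : ¬ q ≤ n), Nat.mod_eq_of_lt h, sub_zero]
  · rw [if_pos h, ← Nat.mod_eq_sub_mod h, sub_self, if_neg (by omega)]

theorem one_sub_X_mul_mk_div {p : ℕ} (F : Type*) [CommRing F] (hp : p ≠ 0) (u : ℕ → F) :
    (1 - PowerSeries.X) * PowerSeries.mk (fun n => u (n / p)) =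
      (1 - PowerSeries.X ^ p) * PowerSeries.expand p hp (PowerSeries.mk u) := by
  ext n
  rw [sub_mul, sub_mul, one_mul, one_mul, map_sub, map_sub, PowerSeries.coeff_X_pow_mul',
    PowerSeries.coeff_expand, PowerSeries.coeff_expand]
  rcases n with _ | n
  · simp [hp]
  rw [PowerSeries.coeff_succ_X_mul]
  simp only [PowerSeries.coeff_mk, Nat.succ_div]
  by_cases h : p ∣ n + 1
  · have hle := Nat.le_of_dvd n.succ_pos h
    have h' : p ∣ n + 1 - p := Nat.dvd_sub h dvd_rfl
    have h2 : (n + 1 - p) / p = n / p := by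
      have h3 := Nat.div_eq_sub_div (Nat.pos_of_ne_zero hp) hle
      rw [Nat.succ_div_of_dvd h] at h3
      simp only [Nat.succ_eq_add_one] at h3
      omega
    rw [if_pos h, if_pos hle, if_pos h', if_pos h, h2]
  · have h' : p ≤ n + 1 → ¬ p ∣ n + 1 - p := fun hle => by
      rwa [← Nat.dvd_add_left (dvd_refl p), Nat.sub_add_cancel hle]
    simp +contextual [h, h']

theorem PowerSeries.expand_char_zmod (hp : p ≠ 0) (f : PowerSeries (ZMod p)) :
    PowerSeries.expand p hp f = f ^ p := by
  rw [← MvPowerSeries.map_frobenius_expand p hp (f := f), ZMod.frobenius_zmod]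
  exact (congrFun (congrArg DFunLike.coe MvPowerSeries.map_id) _).symm

theorem patternSequence_mk_eq (ha : 1 ≤ a) (hak : a < p ^ k) (hr0 : r 0 = 0)
    (hrec : ∀ n, 1 ≤ n → r n = r (n / p) + if n % p ^ k = a then 1 else 0) :
    (1 - PowerSeries.X) ^ p ^ k * PowerSeries.mk r =
      (1 - PowerSeries.X) ^ (p ^ k - 1) * ((1 - PowerSeries.X) * PowerSeries.mk r) ^ p +
        PowerSeries.X ^ a := by
  have hp : p ≠ 0 := (Fact.out : p.Prime).ne_zero
  have hmk : PowerSeries.mk r = PowerSeries.mk (fun n => r (n / p)) +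
      PowerSeries.mk (fun n => if n % p ^ k = a then (1 : ZMod p) else 0) := by
    ext n
    rw [map_add]
    simp only [PowerSeries.coeff_mk]
    rcases Nat.eq_zero_or_pos n with rfl | hn
    · rw [Nat.zero_div, hr0, Nat.zero_mod, if_neg (by omega), add_zero]
    · exact hrec n hn
  have h1 := one_sub_X_mul_mk_div (ZMod p) hp r
  have h2 := one_sub_X_pow_mul_mk_indicator (ZMod p) hak
  have hchar : CharP (PowerSeries (ZMod p)) p :=
    charP_of_injective_ringHom PowerSeries.C_injective p
  have h3 : (1 - PowerSeries.X ^ p : PowerSeries (ZMod p)) = (1 - PowerSeries.X) ^ p := by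
    rw [sub_pow_char, one_pow]
  have h4 : (1 - PowerSeries.X ^ p ^ k : PowerSeries (ZMod p)) = (1 - PowerSeries.X) ^ p ^ k := by
    rw [sub_pow_char_pow, one_pow]
  rw [PowerSeries.expand_char_zmod, h3, ← mul_pow] at h1
  rw [h4] at h2
  obtain ⟨m, hm⟩ : ∃ m, p ^ k = m + 1 := ⟨p ^ k - 1, by omega⟩
  rw [hm] at h2 hmk ⊢
  rw [Nat.add_sub_cancel, ← h1, ← h2, ← mul_assoc, ← pow_succ, ← mul_add, ← hmk]

theorem patternSequence_numerator_ne_zero (hk : 1 ≤ k) {P Q : (ZMod p)[X]}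
    (hQ : Q ≠ 0) :
    (1 - X) ^ (p ^ k - 1) * (((1 - X) * P) ^ p - (1 - X) * P * Q ^ (p - 1)) + X ^ a * Q ^ p
      ≠ 0 := by
  have hp : p.Prime := Fact.out
  have ht : Prime (1 - X : (ZMod p)[X]) := by
    simpa using (prime_X_sub_C (1 : ZMod p)).neg
  refine Prime.pow_mul_pow_sub_add_mul_pow_ne_zero ht (fun h => ?_) hQ hp.two_le fun h => ?_
  · have := eval_dvd h (x := 1)
    simp at this
  · have h1 : p ∣ p ^ k := dvd_pow_self p (by omega)
    have h2 := Nat.dvd_sub h1 h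
    rw [Nat.sub_sub_self (Nat.one_le_pow _ _ hp.pos)] at h2
    exact hp.one_lt.ne' (Nat.dvd_one.1 h2)

theorem patternSequence_lt_of_isConnectionPolynomial (hk : 1 ≤ k) (ha : 1 ≤ a)
    (hak : a < p ^ k) (hr0 : r 0 = 0)
    (hrec : ∀ n, 1 ≤ n → r n = r (n / p) + if n % p ^ k = a then 1 else 0) {N l : ℕ}
    {Q : (ZMod p)[X]} (hQ : IsConnectionPolynomial r N l Q) : N < p ^ k + p * l := by
  have hp : p.Prime := Fact.out
  have hp1 : 1 ≤ p := hp.one_le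
  have hq1 : 1 ≤ p ^ k := Nat.one_le_pow _ _ hp.pos
  set G := PowerSeries.mk r
  set P := PowerSeries.trunc l ((Q : PowerSeries (ZMod p)) * G) with hP
  set E := (1 - X) ^ (p ^ k - 1) * (((1 - X) * P) ^ p - (1 - X) * P * Q ^ (p - 1)) +
    X ^ a * Q ^ p with hE
  have hQ0 : Q ≠ 0 := fun h => by simpa [h] using hQ.coeff_zero
  have hE0 : E ≠ 0 := patternSequence_numerator_ne_zero hk hQ0
  have hdvd : (PowerSeries.X ^ N : PowerSeries (ZMod p)) ∣ (P : PowerSeries (ZMod p)) - Q * G := by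
    refine PowerSeries.X_pow_dvd_iff.2 fun n hn => ?_
    rw [map_sub, Polynomial.coeff_coe, hP, PowerSeries.coeff_trunc]
    split_ifs with h
    · exact sub_self _
    · rw [hQ.coeff_mul n (not_lt.1 h) hn, sub_zero]
  have hEeq : (E : PowerSeries (ZMod p)) =
      (1 - PowerSeries.X : PowerSeries (ZMod p)) ^ (p ^ k - 1) *
      ((((1 - PowerSeries.X : PowerSeries (ZMod p)) * (P : PowerSeries (ZMod p))) ^ p -
        ((1 - PowerSeries.X : PowerSeries (ZMod p)) * ((Q : PowerSeries (ZMod p)) * G)) ^ p) -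
        (1 - PowerSeries.X : PowerSeries (ZMod p)) *
          ((P : PowerSeries (ZMod p)) - (Q : PowerSeries (ZMod p)) * G) *
          (Q : PowerSeries (ZMod p)) ^ (p - 1)) := by
    have h := patternSequence_mk_eq ha hak hr0 hrec
    obtain ⟨m, hm⟩ : ∃ m, p ^ k = m + 1 := ⟨p ^ k - 1, by omega⟩
    have hQp : (Q : PowerSeries (ZMod p)) ^ p = Q * Q ^ (p - 1) := by
      rw [← pow_succ', Nat.sub_add_cancel hp1]
    rw [hE]
    push_cast
    rw [hm, Nat.add_sub_cancel] at h ⊢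
    rw [mul_left_comm _ (Q : PowerSeries (ZMod p)), mul_pow (Q : PowerSeries (ZMod p))]
    linear_combination (-(Q : PowerSeries (ZMod p)) ^ p) * h +
      ((1 - PowerSeries.X) ^ (m + 1) * G) * hQp
  have hEdvd : (X ^ N : (ZMod p)[X]) ∣ E := by
    rw [Polynomial.X_pow_dvd_iff]
    intro n hn
    rw [← Polynomial.coeff_coe]
    revert n
    rw [← PowerSeries.X_pow_dvd_iff, hEeq]
    refine (dvd_sub (dvd_trans ?_ (sub_dvd_pow_sub_pow _ _ p)) ?_).mul_left _
    · rw [← mul_sub]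
      exact hdvd.mul_left _
    · exact (hdvd.mul_left _).mul_right _
  have ht : (1 - X : (ZMod p)[X]).natDegree ≤ 1 :=
    (natDegree_sub_le _ _).trans (by simp)
  have hdeg : E.natDegree < p ^ k + p * l := by
    have hlast : (X ^ a * Q ^ p).natDegree < p ^ k + p * l :=
      (natDegree_mul_le_of_le (natDegree_X_pow_le a)
        (natDegree_pow_le_of_le p hQ.natDegree_le)).trans_lt (by omega)
    by_cases hP0 : P = 0
    · rw [hE, hP0, mul_zero, zero_pow hp.ne_zero]
      simpa using hlast
    have hPl : P.natDegree < l := (natDegree_lt_iff_degree_lt hP0).2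
      (PowerSeries.degree_trunc_lt _ _)
    have htP : ((1 - X) * P).natDegree ≤ l :=
      natDegree_mul_le.trans (by omega)
    have hinner : (((1 - X) * P) ^ p - (1 - X) * P * Q ^ (p - 1)).natDegree ≤ p * l := by
      refine (natDegree_sub_le _ _).trans (max_le (natDegree_pow_le_of_le p htP) ?_)
      refine (natDegree_mul_le_of_le htP
        (natDegree_pow_le_of_le (p - 1) hQ.natDegree_le)).trans_eq ?_
      rw [add_comm, ← Nat.succ_mul, Nat.succ_eq_add_one, Nat.sub_add_cancel hp1]
    refine (natDegree_add_le _ _).trans_lt (max_lt ?_ hlast)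
    exact (natDegree_mul_le_of_le (natDegree_pow_le_of_le _ ht) hinner).trans_lt (by omega)
  exact ((natDegree_X_pow (R := ZMod p) N).ge.trans (natDegree_le_of_dvd hEdvd hE0)).trans_lt hdeg

end PatternSequence

theorem patternSequence_linearComplexity_bounds (p k a : ℕ) [Fact p.Prime]
    (hk : 1 ≤ k) (ha : 1 ≤ a) (hak : a < p ^ k)
    (r : ℕ → ZMod p) (hr0 : r 0 = 0)
    (hrec : ∀ n, 1 ≤ n → r n = r (n / p) + if n % p ^ k = a then 1 else 0)
    (N : ℕ) (hN : 1 ≤ N) :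
    ((N : ℚ) - p ^ k + 1) / p ≤ (linearComplexity r N : ℚ) ∧
      (linearComplexity r N : ℚ) ≤ (((p : ℚ) - 1) * N + p ^ k) / p := by
  have hp : (0 : ℚ) < p := Nat.cast_pos.2 (Fact.out : p.Prime).pos
  have hp1 : (1 : ℚ) ≤ p := Nat.one_le_cast.2 (Fact.out : p.Prime).one_le
  have lower (M : ℕ) : (M : ℚ) + 1 ≤ p ^ k + p * linearComplexity r M := by
    obtain ⟨Q, hQ⟩ := exists_isConnectionPolynomial r M
    exact_mod_cast patternSequence_lt_of_isConnectionPolynomial hk ha hak hr0 hrec hQ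
  have upper (M : ℕ) : (p : ℚ) * linearComplexity r M ≤ (p - 1) * M + p ^ k := by
    induction M with
    | zero =>
      rw [linearComplexity_zero]
      simp only [Nat.cast_zero, mul_zero, zero_add]
      positivity
    | succ M ih =>
      push_cast
      rcases le_max_iff.1 (linearComplexity_succ_le r M) with h | h
      · have h' : (p : ℚ) * linearComplexity r (M + 1) ≤ p * linearComplexity r M := by gcongr
        linarith
      · have hle := linearComplexity_le_self r M
        have h' : (linearComplexity r (M + 1) : ℚ) + linearComplexity r M ≤ M + 1 := by
          exact_mod_cast (by omega :
            linearComplexity r (M + 1) + linearComplexity r M ≤ M + 1)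
        linarith [lower M, mul_le_mul_of_nonneg_left h' hp.le]
  rw [div_le_iff₀ hp, le_div_iff₀ hp]
  constructor
  · linarith [lower N]
  · linarith [upper N]
end

section
/- Let (v_n) be the regular paperfolding sequence over F_2 (with arbitrary initial value v_0 ∈ F_2). Then for every N ≥ 1, (N−3)/2 ≤ L(v_n,N) ≤ N/2 + 2. -/
section LinearComplexity

variable {F : Type*} [Field F]

theorem linearComplexity_spec (u : ℕ → F) (N : ℕ) :
    ∃ c : Fin (linearComplexity u N) → F, ∀ n, n + linearComplexity u N < N →
      u (n + linearComplexity u N) = ∑ i, c i * u (n + i) :=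
  Nat.sInf_mem (s := {L | ∃ c : Fin L → F, ∀ n, n + L < N → u (n + L) = ∑ i, c i * u (n + i)})
    ⟨N, 0, fun n hn => absurd hn (by omega)⟩

theorem linearComplexity_le {u : ℕ → F} {N L : ℕ} (c : Fin L → F)
    (hc : ∀ n, n + L < N → u (n + L) = ∑ i, c i * u (n + i)) : linearComplexity u N ≤ L :=
  Nat.sInf_le ⟨c, hc⟩

open Polynomial in
theorem coeff_polynomial_mul_mk (u : ℕ → F) {Q : F[X]} {L : ℕ} (hQ : Q.natDegree ≤ L) (n : ℕ) :
    PowerSeries.coeff (n + L) ((Q : PowerSeries F) * PowerSeries.mk u) =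
      ∑ i ∈ Finset.range (L + 1), Q.coeff (L - i) * u (n + i) := by
  rw [PowerSeries.coeff_mul, Finset.Nat.sum_antidiagonal_eq_sum_range_succ
    (fun i j => PowerSeries.coeff i (Q : PowerSeries F) * PowerSeries.coeff j (PowerSeries.mk u)),
    ← Finset.sum_range_reflect _ (L + 1)]
  symm
  refine Finset.sum_subset_zero_on_sdiff (Finset.range_mono (by omega)) ?_ ?_
  · intro i hi
    simp only [Finset.mem_sdiff, Finset.mem_range] at hi
    rw [Polynomial.coeff_coe, Polynomial.coeff_eq_zero_of_natDegree_lt (by omega), zero_mul]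
  · intro i hi
    rw [Finset.mem_range] at hi
    rw [Polynomial.coeff_coe, PowerSeries.coeff_mk]
    rw [show L - (L + 1 - 1 - i) = i by omega, show n + (L + 1 - 1 - i) = n + L - i by omega]

open Polynomial in
theorem exists_polynomial_coeff_eq (a : ℕ → F) (L : ℕ) :
    ∃ Q : F[X], Q.natDegree ≤ L ∧ ∀ i ≤ L, Q.coeff i = a i :=
  ⟨PowerSeries.trunc (L + 1) (PowerSeries.mk a),
    Nat.lt_succ_iff.mp (PowerSeries.natDegree_trunc_lt _ _),
    fun i hi => by rw [PowerSeries.coeff_trunc, if_pos (by omega), PowerSeries.coeff_mk]⟩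

open Polynomial in
/-- The reciprocal of the characteristic polynomial of a shortest recurrence. -/
theorem exists_polynomial_of_linearComplexity (u : ℕ → F) (N : ℕ) :
    ∃ Q : F[X], Q ≠ 0 ∧ Q.natDegree ≤ linearComplexity u N ∧
      ∀ m, linearComplexity u N ≤ m → m < N →
        PowerSeries.coeff m ((Q : PowerSeries F) * PowerSeries.mk u) = 0 := by
  obtain ⟨c, hc⟩ := linearComplexity_spec u N
  generalize linearComplexity u N = L at c hc ⊢
  obtain ⟨Q, hdeg, hQ⟩ := exists_polynomial_coeff_eq
    (fun j => if h : L - j < L then -c ⟨L - j, h⟩ else 1) L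
  refine ⟨Q, ?_, hdeg, ?_⟩
  · rintro rfl
    simpa using hQ 0 L.zero_le
  · intro m hm hmN
    obtain ⟨n, rfl⟩ := Nat.exists_eq_add_of_le' hm
    rw [coeff_polynomial_mul_mk u hdeg, Finset.sum_range_succ, Finset.sum_range, hc n hmN,
      hQ _ (by omega)]
    simp only [Nat.sub_self, Nat.sub_zero, lt_irrefl, dite_false, one_mul]
    rw [← Finset.sum_add_distrib]
    refine Finset.sum_eq_zero fun i _ => ?_
    have hi : L - (L - (i : ℕ)) = i := by omega
    rw [hQ _ (by omega)]
    simp [hi]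

open Polynomial in
theorem linearComplexity_le_of_polynomial {u : ℕ → F} {N L : ℕ} {Q : F[X]}
    (h0 : Q.coeff 0 ≠ 0) (hdeg : Q.natDegree ≤ L)
    (hQ : ∀ m, L ≤ m → m < N →
      PowerSeries.coeff m ((Q : PowerSeries F) * PowerSeries.mk u) = 0) :
    linearComplexity u N ≤ L := by
  refine linearComplexity_le (fun i => -(Q.coeff 0)⁻¹ * Q.coeff (L - i)) fun n hn => ?_
  have h := hQ (n + L) (by omega) hn
  rw [coeff_polynomial_mul_mk u hdeg, Finset.sum_range_succ, Finset.sum_range, Nat.sub_self] at h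
  simp only [mul_assoc]
  rw [← Finset.mul_sum]
  field_simp
  linear_combination h

open Polynomial in
theorem exists_polynomial_approximant (u : ℕ → F) (d : ℕ) :
    ∃ Q : F[X], Q ≠ 0 ∧ Q.natDegree ≤ d ∧
      ∀ m, d ≤ m → m < 2 * d →
        PowerSeries.coeff m ((Q : PowerSeries F) * PowerSeries.mk u) = 0 := by
  let A : Matrix (Fin d) (Fin (d + 1)) F := Matrix.of fun n i => u (n + i)
  have hker : LinearMap.ker A.mulVecLin ≠ ⊥ := LinearMap.ker_ne_bot_of_finrank_lt (by simp)
  obtain ⟨x, hx, hx0⟩ := (Submodule.ne_bot_iff _).mp hker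
  obtain ⟨Q, hdeg, hQ⟩ := exists_polynomial_coeff_eq
    (fun j => if h : d - j < d + 1 then x ⟨d - j, h⟩ else 0) d
  have hQx (i : Fin (d + 1)) : Q.coeff (d - i) = x i := by
    have hi : d - (d - (i : ℕ)) = i := by omega
    rw [hQ _ (by omega)]
    simp only [hi, i.is_lt, dite_true]
  refine ⟨Q, ?_, hdeg, fun m hm hmd => ?_⟩
  · rintro rfl
    exact hx0 (funext fun i => by simpa using (hQx i).symm)
  · obtain ⟨n, rfl⟩ := Nat.exists_eq_add_of_le' hm
    rw [coeff_polynomial_mul_mk u hdeg, Finset.sum_range]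
    have h := congrFun (LinearMap.mem_ker.mp hx) ⟨n, by omega⟩
    simp only [Matrix.mulVecLin_apply, Matrix.mulVec, dotProduct, A, Matrix.of_apply,
      Pi.zero_apply] at h
    rw [← h]
    exact Finset.sum_congr rfl fun i _ => by rw [hQx, mul_comm]

end LinearComplexity

section Paperfolding

instance : CharP (PowerSeries (ZMod 2)) 2 :=
  charP_of_injective_ringHom PowerSeries.C_injective 2

theorem PowerSeries.expand_two_eq_sq (f : PowerSeries (ZMod 2)) :
    PowerSeries.expand 2 two_ne_zero f = f ^ 2 := by
  have h := MvPowerSeries.map_frobenius_expand (R := ZMod 2) 2 (by norm_num) (f := f)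
  rw [ZMod.frobenius_zmod, MvPowerSeries.map_id] at h
  exact h

theorem paperfolding_two_mul {v : ℕ → ZMod 2}
    (hrec : ∀ c m : ℕ, Odd m → v (2 ^ c * m) = if m % 4 = 1 then 1 else 0) (n : ℕ) :
    v (2 * n) = v n := by
  rcases eq_or_ne n 0 with rfl | hn
  · rfl
  · obtain ⟨k, m, hm, rfl⟩ := Nat.exists_eq_two_pow_mul_odd hn
    rw [← mul_assoc, ← pow_succ', hrec _ _ hm, hrec _ _ hm]

/-- The generating series of the paperfolding sequence is quadratic over `F₂(X)`. -/
theorem paperfolding_mk_functional_equation {v : ℕ → ZMod 2}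
    (hrec : ∀ c m : ℕ, Odd m → v (2 ^ c * m) = if m % 4 = 1 then 1 else 0) :
    (1 + PowerSeries.X) ^ 4 * (PowerSeries.mk v ^ 2 + PowerSeries.mk v) + PowerSeries.X = 0 := by
  have h2 : (2 : PowerSeries (ZMod 2)) = 0 := CharTwo.two_eq_zero
  have hcoeff : PowerSeries.mk v ^ 2 + PowerSeries.mk v =
      PowerSeries.mk fun n => if n % 4 = 1 then 1 else 0 := by
    ext n
    rw [← PowerSeries.expand_two_eq_sq, map_add, PowerSeries.coeff_expand, PowerSeries.coeff_mk,
      PowerSeries.coeff_mk, PowerSeries.coeff_mk]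
    rcases Nat.even_or_odd' n with ⟨k, rfl | rfl⟩
    · rw [if_pos (dvd_mul_right 2 k), if_neg (by omega), paperfolding_two_mul hrec,
        Nat.mul_div_cancel_left _ two_pos, CharTwo.add_self_eq_zero]
    · rw [if_neg (by omega), zero_add]
      simpa using hrec 0 (2 * k + 1) (odd_two_mul_add_one k)
  have hpow : (1 + PowerSeries.X : PowerSeries (ZMod 2)) ^ 4 = 1 + PowerSeries.X ^ 4 := by
    linear_combination (2 * PowerSeries.X + 3 * PowerSeries.X ^ 2 + 2 * PowerSeries.X ^ 3) * h2
  rw [hcoeff, hpow, ← CharTwo.sub_eq_add, sub_eq_zero, add_mul, one_mul]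
  ext n
  rw [map_add, PowerSeries.coeff_X_pow_mul', PowerSeries.coeff_X, PowerSeries.coeff_mk]
  split_ifs with h1 h2 h3 h3
  all_goals try rw [PowerSeries.coeff_mk]
  all_goals try split_ifs
  all_goals first | omega | simp [CharTwo.add_self_eq_zero]

open Polynomial

theorem prime_X_add_one : Prime (X + 1 : (ZMod 2)[X]) := by
  simpa only [C_1, CharTwo.sub_eq_add] using prime_X_sub_C (1 : ZMod 2)

theorem eq_zero_of_paperfolding_descent (P S : (ZMod 2)[X])
    (h : P ^ 2 + (X + 1) ^ 2 * P * S + X * S ^ 2 = 0) : S = 0 := by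
  have h2 : (2 : (ZMod 2)[X]) = 0 := CharTwo.two_eq_zero
  have hdeg : (X + 1 : (ZMod 2)[X]).natDegree = 1 := natDegree_X_add_C 1
  have ht0 : (X + 1 : (ZMod 2)[X]) ≠ 0 := X_add_C_ne_zero 1
  have ht : Prime (X + 1 : (ZMod 2)[X]) := prime_X_add_one
  induction hn : S.natDegree using Nat.strong_induction_on generalizing P S with
  | _ n ih =>
    have hsq : (P + S) ^ 2 = (X + 1) * (S ^ 2 + (X + 1) * P * S) := by
      linear_combination h + (P * S - X * S ^ 2 - (X + 1) ^ 2 * P * S) * h2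
    obtain ⟨U, hU⟩ := ht.dvd_of_dvd_pow (Dvd.intro _ hsq.symm)
    have hU2 : (X + 1) * U ^ 2 = S ^ 2 + (X + 1) * P * S :=
      mul_left_cancel₀ ht0 (by rw [← hsq, hU]; ring)
    obtain ⟨S', rfl⟩ : X + 1 ∣ S :=
      ht.dvd_of_dvd_pow (n := 2) ⟨U ^ 2 - P * S, by linear_combination -hU2⟩
    obtain rfl : P = (X + 1) * (U - S') := by linear_combination hU
    by_contra hS
    have hS' : S' ≠ 0 := right_ne_zero_of_mul hS
    rw [natDegree_mul ht0 hS', hdeg] at hn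
    refine hS' (ih S'.natDegree (by omega) (U - S') S' ?_ rfl)
    exact mul_left_cancel₀ (pow_ne_zero 2 ht0) (by linear_combination h)

theorem paperfolding_norm_ne_zero (P : (ZMod 2)[X]) {Q : (ZMod 2)[X]} (hQ : Q ≠ 0) :
    (1 + X) ^ 4 * (P ^ 2 + P * Q) + X * Q ^ 2 ≠ 0 := by
  intro h
  have ht0 : (X + 1 : (ZMod 2)[X]) ≠ 0 := X_add_C_ne_zero 1
  have ht : Prime (X + 1 : (ZMod 2)[X]) := prime_X_add_one
  obtain ⟨R, rfl⟩ : X + 1 ∣ Q := ht.dvd_of_dvd_pow (n := 2)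
    ⟨(1 + X) ^ 3 * (P ^ 2 + P * Q) + Q ^ 2, by linear_combination -h⟩
  have hR : (X + 1) ^ 2 * (P ^ 2 + P * ((X + 1) * R)) + X * R ^ 2 = 0 :=
    mul_left_cancel₀ (pow_ne_zero 2 ht0) (by linear_combination h)
  obtain ⟨S, rfl⟩ : X + 1 ∣ R := ht.dvd_of_dvd_pow (n := 2)
    ⟨(1 + X) * (P ^ 2 + P * ((X + 1) * R)) + R ^ 2, by linear_combination -hR⟩
  have hS : S = 0 := eq_zero_of_paperfolding_descent P S
    (mul_left_cancel₀ (pow_ne_zero 2 ht0) (by linear_combination hR))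
  exact hQ (by rw [hS, mul_zero, mul_zero])

theorem paperfolding_approximation_bound {v : ℕ → ZMod 2}
    (hrec : ∀ c m : ℕ, Odd m → v (2 ^ c * m) = if m % 4 = 1 then 1 else 0)
    {Q : (ZMod 2)[X]} {L M : ℕ} (hQ : Q ≠ 0) (hdeg : Q.natDegree ≤ L)
    (h : ∀ m, L ≤ m → m < M →
      PowerSeries.coeff m ((Q : PowerSeries (ZMod 2)) * PowerSeries.mk v) = 0) :
    M ≤ 2 * L + 3 := by
  set G := PowerSeries.mk v
  set P : (ZMod 2)[X] := PowerSeries.trunc L ((Q : PowerSeries (ZMod 2)) * G) with hP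
  have hPQ : (PowerSeries.X : PowerSeries (ZMod 2)) ^ M ∣ (P : PowerSeries (ZMod 2)) - Q * G := by
    refine PowerSeries.X_pow_dvd_iff.mpr fun m hm => ?_
    rw [map_sub, coeff_coe, hP, PowerSeries.coeff_trunc]
    split_ifs with hmL
    · exact sub_self _
    · rw [h m (by omega) hm, sub_self]
  set E := (1 + X) ^ 4 * (P ^ 2 + P * Q) + X * Q ^ 2 with hE
  have hE0 : E ≠ 0 := paperfolding_norm_ne_zero P hQ
  have hdvd : (PowerSeries.X : PowerSeries (ZMod 2)) ^ M ∣ E := by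
    have hfac (p q : PowerSeries (ZMod 2)) :
        (1 + PowerSeries.X) ^ 4 * (p ^ 2 + p * q) + PowerSeries.X * q ^ 2 =
          (p - q * G) * ((1 + PowerSeries.X) ^ 4 * (p + q * G + q)) := by
      linear_combination q ^ 2 * paperfolding_mk_functional_equation hrec
    rw [hE]
    push_cast
    rw [hfac]
    exact hPQ.mul_right _
  have hEdeg : E.natDegree ≤ 2 * L + 3 := by
    have h1 : (1 + X : (ZMod 2)[X]).natDegree ≤ 1 := by compute_degree
    rcases L with _ | l
    · have hP0 : P = 0 := rfl
      simp only [hE, hP0, ne_eq, OfNat.ofNat_ne_zero, not_false_eq_true, zero_pow, zero_mul,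
        add_zero, mul_zero, zero_add]
      exact (natDegree_mul_le_of_le natDegree_X_le (natDegree_pow_le_of_le 2 hdeg)).trans
        (by norm_num)
    · have hPdeg : P.natDegree ≤ l := Nat.lt_succ_iff.mp (PowerSeries.natDegree_trunc_lt _ _)
      refine natDegree_add_le_of_degree_le ?_ ?_
      · refine (natDegree_mul_le_of_le (natDegree_pow_le_of_le 4 h1)
          (natDegree_add_le_of_degree_le (n := 2 * l + 1) ?_ ?_)).trans (by omega)
        · exact (natDegree_pow_le_of_le 2 hPdeg).trans (by omega)
        · exact (natDegree_mul_le_of_le hPdeg hdeg).trans (by omega)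
      · exact (natDegree_mul_le_of_le natDegree_X_le (natDegree_pow_le_of_le 2 hdeg)).trans
          (by omega)
  by_contra hM
  refine hE0 (Polynomial.ext fun n => ?_)
  rcases lt_or_ge n M with hn | hn
  · simpa using PowerSeries.X_pow_dvd_iff.mp hdvd n hn
  · exact coeff_eq_zero_of_natDegree_lt (by omega)

end Paperfolding

theorem paperfolding_linearComplexity_bounds (v : ℕ → ZMod 2)
    (hrec : ∀ c m : ℕ, Odd m → v (2 ^ c * m) = if m % 4 = 1 then 1 else 0)
    (N : ℕ) (hN : 1 ≤ N) :
    ((N : ℚ) - 3) / 2 ≤ (linearComplexity v N : ℚ) ∧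
      (linearComplexity v N : ℚ) ≤ (N : ℚ) / 2 + 2 := by
  have hlower : N ≤ 2 * linearComplexity v N + 3 := by
    obtain ⟨Q, hQ, hdeg, h⟩ := exists_polynomial_of_linearComplexity v N
    exact paperfolding_approximation_bound hrec hQ hdeg h
  have hupper : 2 * linearComplexity v N ≤ N + 4 := by
    obtain ⟨d, hd, hd'⟩ : ∃ d, N + 3 ≤ 2 * d ∧ 2 * d ≤ N + 4 := ⟨(N + 4) / 2, by omega, by omega⟩
    obtain ⟨Q, hQ, hdeg, h⟩ := exists_polynomial_approximant v d
    obtain ⟨R, hR, hR0⟩ := Q.exists_eq_pow_rootMultiplicity_mul_and_not_dvd hQ 0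
    rw [Polynomial.C_0, sub_zero] at hR hR0
    generalize Q.rootMultiplicity 0 = k at hR
    subst hR
    have hRne : R ≠ 0 := right_ne_zero_of_mul hQ
    rw [Polynomial.natDegree_X_pow_mul _ hRne] at hdeg
    have hcoeff (m : ℕ) (hm : d - k ≤ m) (hm' : m < 2 * d - k) :
        PowerSeries.coeff m ((R : PowerSeries (ZMod 2)) * PowerSeries.mk v) = 0 := by
      have := h (m + k) (by omega) (by omega)
      rwa [Polynomial.coe_mul, Polynomial.coe_pow, Polynomial.coe_X, mul_assoc,
        PowerSeries.coeff_X_pow_mul] at this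
    have hk := paperfolding_approximation_bound hrec hRne (L := d - k) (by omega) hcoeff
    have := linearComplexity_le_of_polynomial (L := d) (N := N)
      (fun h0 => hR0 (Polynomial.X_dvd_iff.mpr h0)) (by omega)
      (fun m hm hm' => hcoeff m (by omega) (by omega))
    omega
  have hlower' : (N : ℚ) ≤ 2 * linearComplexity v N + 3 := by exact_mod_cast hlower
  have hupper' : 2 * (linearComplexity v N : ℚ) ≤ N + 4 := by exact_mod_cast hupper
  constructor <;> linarith
end

section
/- Let k ≥ 1 and let (r_n) be the pattern sequence over F_2 with pattern the all-one string of length k, i.e. p = 2 and a = 2^k − 1. Then for every N ≥ 1, L(r_n,N) = 2(2^k − 1)·⌊N/(4(2^k − 1))⌋ + 2^k if 2^k ≤ (N mod 4(2^k − 1)) ≤ 3(2^k − 1), and L(r_n,N) = 2(2^k − 1)·⌊(N + 2^k − 2)/(4(2^k − 1))⌋ otherwise. -/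
open Polynomial

section Functional

variable {F : Type*} [Field F]

/-- The functional `φ` kills `X ^ n * P` for `n < b` but not for `n = b`. -/
def VanishesToOrder (φ : F[X] →ₗ[F] F) (P : F[X]) (b : ℕ) : Prop :=
  (∀ n < b, φ (X ^ n * P) = 0) ∧ φ (X ^ b * P) ≠ 0

variable {φ : F[X] →ₗ[F] F} {P : F[X]} {b : ℕ}

theorem VanishesToOrder.apply_mul_eq_zero (h : VanishesToOrder φ P b) {R : F[X]}
    (hR : R.natDegree < b) : φ (R * P) = 0 := by
  rw [R.as_sum_range' b hR, Finset.sum_mul, map_sum]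
  refine Finset.sum_eq_zero fun i hi => ?_
  rw [← C_mul_X_pow_eq_monomial, mul_assoc, ← smul_eq_C_mul, map_smul,
    h.1 i (Finset.mem_range.1 hi), smul_zero]

theorem VanishesToOrder.apply_mul_ne_zero (h : VanishesToOrder φ P b) {R : F[X]}
    (hR : R.Monic) (hb : R.natDegree = b) : φ (R * P) ≠ 0 := by
  rw [hR.as_sum, hb, add_mul, map_add, Finset.sum_mul, map_sum, Finset.sum_eq_zero, add_zero]
  · exact h.2
  · intro i hi
    rw [mul_assoc, ← smul_eq_C_mul, map_smul, h.1 i (Finset.mem_range.1 hi), smul_zero]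

theorem VanishesToOrder.taylor (h : VanishesToOrder φ P b) (t : F) :
    VanishesToOrder (φ ∘ₗ Polynomial.taylor t) (Polynomial.taylor (-t) P) b := by
  have key (n : ℕ) : (φ ∘ₗ Polynomial.taylor t) (X ^ n * Polynomial.taylor (-t) P) =
      φ ((X + C t) ^ n * P) := by
    rw [LinearMap.comp_apply, taylor_mul, taylor_X_pow, taylor_taylor, add_neg_cancel, taylor_zero]
  have hdeg (n : ℕ) : ((X + C t) ^ n).natDegree = n := by simp
  refine ⟨fun n hn => ?_, ?_⟩
  · rw [key]
    exact h.apply_mul_eq_zero (by rwa [hdeg])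
  · rw [key]
    exact h.apply_mul_ne_zero ((monic_X_add_C t).pow b) (hdeg b)

variable {u : ℕ → F} {N : ℕ}

theorem VanishesToOrder.lt_of_recurrence (hφ : ∀ n, φ (X ^ n) = u n) (h : VanishesToOrder φ P b)
    (hN : P.natDegree + b < N) {L : ℕ} {c : Fin L → F}
    (hc : ∀ n, n + L < N → u (n + L) = ∑ i, c i * u (n + i)) : b < L := by
  by_contra! hL
  set S : F[X] := ∑ i : Fin L, C (c i) * X ^ (i : ℕ) with hS
  have hSdeg : S.degree < L := by
    refine (degree_sum_le _ _).trans_lt ((Finset.sup_lt_iff (WithBot.bot_lt_coe L)).2 fun i _ => ?_)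
    exact (degree_C_mul_X_pow_le _ _).trans_lt (Nat.cast_lt.2 i.2)
  have hmonic : (X ^ L - S).Monic := monic_X_pow_sub hSdeg
  have hdeg : (X ^ L - S).natDegree = L := by
    refine natDegree_eq_of_degree_eq_some ?_
    rw [degree_sub_eq_left_of_degree_lt (by rwa [degree_X_pow]), degree_X_pow]
  have hkill (n : ℕ) (hn : n + L < N) : φ (X ^ n * (X ^ L - S)) = 0 := by
    rw [mul_sub, map_sub, ← pow_add, hφ, hc n hn, hS, Finset.mul_sum, map_sum, sub_eq_zero]
    refine Finset.sum_congr rfl fun i _ => ?_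
    rw [mul_left_comm, ← pow_add, ← smul_eq_C_mul, map_smul, hφ, smul_eq_mul]
  refine h.apply_mul_ne_zero (R := X ^ (b - L) * (X ^ L - S)) ((monic_X_pow _).mul hmonic) ?_ ?_
  · rw [(monic_X_pow _).natDegree_mul hmonic, natDegree_X_pow, hdeg]
    omega
  · rw [mul_right_comm, P.as_sum_range_C_mul_X_pow, Finset.mul_sum, Finset.sum_mul, map_sum]
    refine Finset.sum_eq_zero fun i hi => ?_
    rw [mul_left_comm, mul_assoc, ← pow_add, ← smul_eq_C_mul, map_smul, hkill, smul_zero]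
    have := Finset.mem_range.1 hi
    omega

theorem Polynomial.Monic.exists_recurrence (hφ : ∀ n, φ (X ^ n) = u n) (hP : P.Monic)
    (h : ∀ n < b, φ (X ^ n * P) = 0) (hN : N ≤ P.natDegree + b) :
    ∃ c : Fin P.natDegree → F, ∀ n, n + P.natDegree < N →
      u (n + P.natDegree) = ∑ i, c i * u (n + i) := by
  refine ⟨fun i => -P.coeff i, fun n hn => ?_⟩
  have hz := h n (by omega)
  rw [hP.as_sum, mul_add, map_add, ← pow_add, hφ, Finset.mul_sum, map_sum] at hz
  rw [eq_neg_of_add_eq_zero_left hz, Finset.sum_range, ← Finset.sum_neg_distrib]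
  refine Finset.sum_congr rfl fun i _ => ?_
  rw [mul_left_comm, ← pow_add, ← smul_eq_C_mul, map_smul, hφ, smul_eq_mul, neg_mul]

theorem linearComplexity_le_natDegree (hφ : ∀ n, φ (X ^ n) = u n) (hP : P.Monic)
    (h : VanishesToOrder φ P b) (hN : N ≤ P.natDegree + b) :
    linearComplexity u N ≤ P.natDegree :=
  Nat.sInf_le (hP.exists_recurrence hφ h.1 hN)

/-- Two consecutive convergent denominators `P` and `Q` determine the linear complexity. -/
theorem linearComplexity_eq_natDegree {Q : F[X]} {d : ℕ} (hφ : ∀ n, φ (X ^ n) = u n)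
    (hP : VanishesToOrder φ P b) (hQ : Q.Monic) (hQd : VanishesToOrder φ Q d)
    (hPQ : Q.natDegree ≤ b + 1) (hN : P.natDegree + b < N) (hN' : N ≤ Q.natDegree + d) :
    linearComplexity u N = Q.natDegree := by
  refine le_antisymm (linearComplexity_le_natDegree hφ hQ hQd hN')
    (le_csInf ⟨_, hQ.exists_recurrence hφ hQd.1 hN'⟩ ?_)
  rintro L ⟨c, hc⟩
  have := hP.lt_of_recurrence hφ hN hc
  omega

end Functional

section PatternSequence

open Classical in
/-- The power series `∑ X ^ (2 ^ i)`. -/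
noncomputable def powTwoSeries : PowerSeries (ZMod 2) :=
  PowerSeries.mk fun n => if ∃ i, n = 2 ^ i then 1 else 0

theorem coeff_powTwoSeries_two_mul {n : ℕ} (hn : n ≠ 0) :
    powTwoSeries.coeff (2 * n) = powTwoSeries.coeff n := by
  classical
  simp only [powTwoSeries, PowerSeries.coeff_mk]
  refine if_congr ⟨?_, ?_⟩ rfl rfl
  · rintro ⟨_ | i, hi⟩
    · omega
    · exact ⟨i, by rw [pow_succ'] at hi; omega⟩
  · rintro ⟨i, rfl⟩
    exact ⟨i + 1, (pow_succ' 2 i).symm⟩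

theorem coeff_powTwoSeries_zero : powTwoSeries.coeff 0 = 0 := by
  rw [powTwoSeries, PowerSeries.coeff_mk, if_neg]
  rintro ⟨i, hi⟩
  exact (Nat.two_pow_pos i).ne hi

theorem coeff_powTwoSeries_one : powTwoSeries.coeff 1 = 1 := by
  rw [powTwoSeries, PowerSeries.coeff_mk, if_pos ⟨0, rfl⟩]

theorem powTwoSeries_sq : powTwoSeries ^ 2 = powTwoSeries + PowerSeries.X := by
  have hfrob : powTwoSeries ^ 2 = powTwoSeries.expand 2 two_ne_zero := by
    have h := MvPowerSeries.map_frobenius_expand (R := ZMod 2) 2 two_ne_zero 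
      (f := powTwoSeries)
    rw [ZMod.frobenius_zmod, MvPowerSeries.map_id] at h
    exact h.symm
  ext n
  rw [hfrob, PowerSeries.coeff_expand, map_add, PowerSeries.coeff_X]
  split_ifs with h2 h1 h1
  · omega
  · obtain ⟨m, rfl⟩ := h2
    rw [Nat.mul_div_cancel_left _ two_pos, add_zero]
    rcases eq_or_ne m 0 with rfl | hm
    · rfl
    · exact (coeff_powTwoSeries_two_mul hm).symm
  · subst h1
    rw [coeff_powTwoSeries_one]; rfl
  · rw [add_zero, powTwoSeries, PowerSeries.coeff_mk, if_neg]
    rintro ⟨_ | i, rfl⟩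
    · exact h1 rfl
    · exact h2 (dvd_pow_self 2 i.succ_ne_zero)

theorem two_eq_zero_powerSeries : (2 : PowerSeries (ZMod 2)) = 0 := by
  rw [← map_ofNat (PowerSeries.C (R := ZMod 2)) 2, show (OfNat.ofNat 2 : ZMod 2) = 0 from rfl,
    map_zero]

theorem powTwoSeries_pow_add_four (n : ℕ) :
    powTwoSeries ^ (n + 4) = powTwoSeries ^ (n + 2) + PowerSeries.X ^ 2 * powTwoSeries ^ n := by
  have h4 : powTwoSeries ^ 4 = powTwoSeries ^ 2 + PowerSeries.X ^ 2 := by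
    rw [show 4 = 2 * 2 from rfl, pow_mul, powTwoSeries_sq, add_sq, powTwoSeries_sq,
      two_eq_zero_powerSeries, zero_mul, zero_mul, add_zero]
  rw [pow_add, h4, pow_add]
  ring

theorem exists_powTwoSeries_eq_X_mul :
    ∃ U : PowerSeries (ZMod 2), powTwoSeries = PowerSeries.X * U ∧ U.coeff 0 = 1 := by
  obtain ⟨U, hU⟩ := PowerSeries.X_dvd_iff.2
    ((PowerSeries.coeff_zero_eq_constantCoeff_apply _).symm.trans coeff_powTwoSeries_zero)
  refine ⟨U, hU, ?_⟩
  rw [← PowerSeries.coeff_succ_X_mul, ← hU, zero_add, coeff_powTwoSeries_one]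

theorem coeff_powTwoSeries_pow_self (n : ℕ) : (powTwoSeries ^ n).coeff n = 1 := by
  obtain ⟨U, hU, h1⟩ := exists_powTwoSeries_eq_X_mul
  rw [PowerSeries.coeff_zero_eq_constantCoeff_apply] at h1
  rw [hU, mul_pow, PowerSeries.coeff_X_pow_mul', if_pos le_rfl, Nat.sub_self,
    PowerSeries.coeff_zero_eq_constantCoeff_apply, map_pow, h1, one_pow]

theorem coeff_powTwoSeries_pow_of_lt {l n : ℕ} (h : l < n) : (powTwoSeries ^ n).coeff l = 0 := by
  obtain ⟨U, hU, -⟩ := exists_powTwoSeries_eq_X_mul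
  rw [hU, mul_pow, PowerSeries.coeff_X_pow_mul', if_neg h.not_ge]

/-- Denominators of the convergents of `∑ X ^ (-2 ^ i)`, whose continued fraction expansion
is `[0; X + 1, X, X, …]`. -/
noncomputable def convergentDenom : ℕ → (ZMod 2)[X]
  | 0 => 1
  | 1 => X + 1
  | n + 2 => X * convergentDenom (n + 1) + convergentDenom n

theorem convergentDenom_monic_natDegree (n : ℕ) :
    (convergentDenom n).Monic ∧ (convergentDenom n).natDegree = n := by
  induction n using Nat.twoStepInduction with
  | zero => simp [convergentDenom]
  | one => exact ⟨monic_X_add_C 1, natDegree_X_add_C 1⟩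
  | more n h0 h1 =>
    have hd : (X * convergentDenom (n + 1)).natDegree = n + 2 := by
      rw [natDegree_X_mul h1.1.ne_zero, h1.2]
    have hlt : (convergentDenom n).natDegree < (X * convergentDenom (n + 1)).natDegree := by
      rw [hd, h0.2]; omega
    refine ⟨(monic_X.mul h1.1).add_of_left (degree_lt_degree hlt), ?_⟩
    rw [convergentDenom, natDegree_add_eq_left_of_natDegree_lt hlt, hd]

/-- The functional sending `X ^ n` to `w n`. -/
noncomputable def momentFunctional (w : ℕ → ZMod 2) : (ZMod 2)[X] →ₗ[ZMod 2] ZMod 2 :=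
  lsum fun n => LinearMap.mulRight (ZMod 2) (w n)

theorem momentFunctional_X_pow (w : ℕ → ZMod 2) (n : ℕ) :
    momentFunctional w (X ^ n) = w n := by
  rw [momentFunctional, lsum_apply, ← monomial_one_right_eq_X_pow, sum_monomial_index] <;> simp

/-- The functional whose generating series is `powTwoSeries`. -/
noncomputable def powTwoFunctional : (ZMod 2)[X] →ₗ[ZMod 2] ZMod 2 :=
  momentFunctional fun n => powTwoSeries.coeff n

theorem powTwoFunctional_X_pow (n : ℕ) : powTwoFunctional (X ^ n) = powTwoSeries.coeff n :=
  momentFunctional_X_pow _ n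

theorem powTwoFunctional_convergentDenom_succ (j c : ℕ) :
    powTwoFunctional (X ^ (c + 1) * convergentDenom j) =
      (powTwoSeries ^ (2 * j + 1)).coeff (c + 1 + j) := by
  induction j using Nat.twoStepInduction generalizing c with
  | zero => simp [convergentDenom, powTwoFunctional_X_pow]
  | one =>
    have h3 : powTwoSeries ^ (2 * 1 + 1) =
        PowerSeries.X * powTwoSeries + powTwoSeries + PowerSeries.X := by
      rw [pow_succ, pow_mul, pow_one, powTwoSeries_sq, add_mul, ← sq, powTwoSeries_sq]
      ring
    rw [h3, map_add, map_add, PowerSeries.coeff_succ_X_mul, PowerSeries.coeff_X,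
      if_neg (by omega), convergentDenom, mul_add, mul_one, ← pow_succ, map_add,
      powTwoFunctional_X_pow, powTwoFunctional_X_pow]
    ring
  | more j h0 h1 =>
    rw [convergentDenom, mul_add, ← mul_assoc, ← pow_succ, map_add, h1, h0,
      show 2 * (j + 2) + 1 = 2 * j + 1 + 4 by ring, powTwoSeries_pow_add_four, map_add,
      show c + 1 + (j + 2) = c + 1 + j + 2 by ring, PowerSeries.coeff_X_pow_mul]
    congr 2
    congr 1
    ring

theorem powTwoFunctional_convergentDenom_two_mul (q : ℕ) :
    powTwoFunctional (convergentDenom (2 * q)) = 0 := by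
  induction q with
  | zero => simpa [convergentDenom, -PowerSeries.coeff_zero_eq_constantCoeff,
      coeff_powTwoSeries_zero] using powTwoFunctional_X_pow 0
  | succ q ih =>
    have h := powTwoFunctional_convergentDenom_succ (2 * q + 1) 0
    rw [zero_add, pow_one, coeff_powTwoSeries_pow_of_lt (by omega)] at h
    rw [show 2 * (q + 1) = 2 * q + 2 by ring, convergentDenom, map_add, ih, h, add_zero]

/-- The functional with generating series `∑ X ^ (m * 2 ^ i)`. -/
noncomputable def dilatedFunctional (m : ℕ) : (ZMod 2)[X] →ₗ[ZMod 2] ZMod 2 :=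
  momentFunctional fun n => if m ∣ n then powTwoSeries.coeff (n / m) else 0

theorem dilatedFunctional_X_pow_mul_expand {m : ℕ} (hm : 0 < m) (n : ℕ) (p : (ZMod 2)[X]) :
    dilatedFunctional m (X ^ n * expand (ZMod 2) m p) =
      if m ∣ n then powTwoFunctional (X ^ (n / m) * p) else 0 := by
  induction p using Polynomial.induction_on' with
  | add p q hp hq =>
    rw [map_add, mul_add, map_add, hp, hq, mul_add, map_add]
    split_ifs <;> simp
  | monomial i a =>
    rw [expand_monomial, ← C_mul_X_pow_eq_monomial, ← C_mul_X_pow_eq_monomial, mul_left_comm,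
      mul_left_comm (X ^ (n / m)), ← smul_eq_C_mul, ← smul_eq_C_mul, map_smul, map_smul, ← pow_add, ← pow_add,
      dilatedFunctional, momentFunctional_X_pow, powTwoFunctional_X_pow, mul_comm i m]
    have h : m ∣ n + m * i ↔ m ∣ n := (Nat.dvd_add_left (dvd_mul_right m i))
    simp only [h, Nat.add_mul_div_left _ _ hm]
    split_ifs <;> simp

theorem vanishesToOrder_even {m : ℕ} (hm : 0 < m) (q : ℕ) :
    VanishesToOrder (dilatedFunctional m) (expand (ZMod 2) m (convergentDenom (2 * q)))
      (2 * m * q + m) := by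
  refine ⟨fun n hn => ?_, ?_⟩
  · rw [dilatedFunctional_X_pow_mul_expand hm]
    split_ifs with h
    · obtain ⟨c, rfl⟩ := h
      rw [Nat.mul_div_cancel_left _ hm]
      rcases c with _ | c
      · rw [pow_zero, one_mul, powTwoFunctional_convergentDenom_two_mul]
      · have : c + 1 < 2 * q + 1 := lt_of_mul_lt_mul_left (by linarith) hm.le
        rw [powTwoFunctional_convergentDenom_succ, coeff_powTwoSeries_pow_of_lt (by omega)]
    · rfl
  · rw [show 2 * m * q + m = m * (2 * q + 1) by ring, dilatedFunctional_X_pow_mul_expand hm,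
      if_pos (dvd_mul_right _ _), Nat.mul_div_cancel_left _ hm,
      powTwoFunctional_convergentDenom_succ, show 2 * q + 1 + 2 * q = 2 * (2 * q) + 1 by ring,
      coeff_powTwoSeries_pow_self]
    exact one_ne_zero

theorem vanishesToOrder_odd {m : ℕ} (hm : 0 < m) (q : ℕ) :
    VanishesToOrder (dilatedFunctional m) (X * expand (ZMod 2) m (convergentDenom (2 * q + 1)))
      (2 * m * (q + 1) - 1) := by
  have hpos : 0 < 2 * m * (q + 1) := by positivity
  refine ⟨fun n hn => ?_, ?_⟩
  · rw [← mul_assoc, ← pow_succ, dilatedFunctional_X_pow_mul_expand hm]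
    split_ifs with h
    · obtain ⟨c, hc⟩ := h
      rw [hc, Nat.mul_div_cancel_left _ hm]
      rcases c with _ | c
      · omega
      · have : c + 1 < 2 * (q + 1) := lt_of_mul_lt_mul_left (by
          rw [← hc, show m * (2 * (q + 1)) = 2 * m * (q + 1) by ring]; omega) hm.le
        rw [powTwoFunctional_convergentDenom_succ, coeff_powTwoSeries_pow_of_lt (by omega)]
    · rfl
  · rw [← mul_assoc, ← pow_succ, Nat.sub_add_cancel hpos,
      show 2 * m * (q + 1) = m * (2 * q + 1 + 1) by ring, dilatedFunctional_X_pow_mul_expand hm,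
      if_pos (dvd_mul_right _ _), Nat.mul_div_cancel_left _ hm,
      powTwoFunctional_convergentDenom_succ,
      show 2 * q + 1 + 1 + (2 * q + 1) = 2 * (2 * q + 1) + 1 by ring,
      coeff_powTwoSeries_pow_self]
    exact one_ne_zero

theorem cast_choose_two_mul (n j : ℕ) :
    (n.choose (2 * j) : ZMod 2) = (n / 2).choose j := by
  have h := Choose.choose_modEq_choose_mod_mul_choose_div_nat (n := n) (k := 2 * j) (p := 2)
  rw [Nat.mul_mod_right, Nat.choose_zero_right, one_mul, Nat.mul_div_cancel_left _ two_pos] at h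
  exact (ZMod.natCast_eq_natCast_iff _ _ _).2 h

theorem cast_choose_two_pow_sub_one (k n : ℕ) :
    (n.choose (2 ^ k - 1) : ZMod 2) = if n % 2 ^ k = 2 ^ k - 1 then 1 else 0 := by
  induction k generalizing n with
  | zero => simp [Nat.mod_one]
  | succ k ih =>
    have h := Choose.choose_modEq_choose_mod_mul_choose_div_nat (n := n) (k := 2 ^ (k + 1) - 1)
      (p := 2)
    have hpos : 0 < 2 ^ k := by positivity
    have hmod : (2 ^ (k + 1) - 1) % 2 = 1 := by omega
    have hdiv : (2 ^ (k + 1) - 1) / 2 = 2 ^ k - 1 := by omega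
    rw [hmod, hdiv, Nat.choose_one_right] at h
    rw [(ZMod.natCast_eq_natCast_iff _ _ _).2 h, Nat.cast_mul, ih, pow_succ', Nat.mod_mul]
    have hlt := Nat.mod_lt (n / 2) hpos
    rcases Nat.mod_two_eq_zero_or_one n with h2 | h2 <;> rw [h2]
    · rw [if_neg (show ¬ (0 + 2 * (n / 2 % 2 ^ k) = 2 * 2 ^ k - 1) by omega)]
      simp
    · simp only [Nat.cast_one, one_mul]
      congr 1
      refine propext ⟨fun _ => ?_, fun _ => ?_⟩ <;> omega

theorem dilatedFunctional_X_pow {m : ℕ} (n : ℕ) : dilatedFunctional m (X ^ n) =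
    if m ∣ n then powTwoSeries.coeff (n / m) else 0 := momentFunctional_X_pow _ n

theorem dilatedFunctional_X_add_one_pow {m : ℕ} (hm : 0 < m) (n : ℕ) :
    dilatedFunctional m ((X + 1) ^ n) =
      ∑ i ∈ Finset.range n, (n.choose (m * 2 ^ i) : ZMod 2) := by
  have hw {j : ℕ} (hj : j ≤ n) : dilatedFunctional m (X ^ j) =
      ∑ i ∈ Finset.range n, if j = m * 2 ^ i then 1 else 0 := by
    rw [dilatedFunctional_X_pow, powTwoSeries, PowerSeries.coeff_mk, ← ite_and]
    split_ifs with h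
    · obtain ⟨⟨c, rfl⟩, i, hi⟩ := h
      rw [Nat.mul_div_cancel_left _ hm] at hi
      subst hi
      have hin : i < n := i.lt_two_pow_self.trans_le ((Nat.le_mul_of_pos_left _ hm).trans hj)
      rw [Finset.sum_eq_single_of_mem i (Finset.mem_range.2 hin), if_pos rfl]
      intro l _ hl
      rw [if_neg]
      intro h
      exact hl (Nat.pow_right_injective le_rfl (Nat.eq_of_mul_eq_mul_left hm h)).symm
    · refine (Finset.sum_eq_zero fun i _ => if_neg ?_).symm
      rintro rfl
      exact h ⟨dvd_mul_right _ _, i, Nat.mul_div_cancel_left _ hm⟩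
  rw [add_pow, map_sum]
  calc _ = ∑ j ∈ Finset.range (n + 1), ∑ i ∈ Finset.range n,
        if j = m * 2 ^ i then (n.choose j : ZMod 2) else 0 := by
        refine Finset.sum_congr rfl fun j hj => ?_
        rw [one_pow, mul_one, mul_comm, ← C_eq_natCast, ← smul_eq_C_mul, map_smul,
          hw (Nat.lt_succ_iff.1 (Finset.mem_range.1 hj)), smul_eq_mul, Finset.mul_sum]
        simp
    _ = _ := by
        rw [Finset.sum_comm]
        refine Finset.sum_congr rfl fun i _ => ?_
        rw [Finset.sum_ite_eq']
        split_ifs with h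
        · rfl
        · rw [Finset.mem_range] at h
          rw [Nat.choose_eq_zero_of_lt (by omega), Nat.cast_zero]

theorem sum_range_cast_choose_mul_two_pow {m n M : ℕ} (hm : 0 < m) (hM : n ≤ M) :
    ∑ i ∈ Finset.range M, (n.choose (m * 2 ^ i) : ZMod 2) =
      ∑ i ∈ Finset.range n, (n.choose (m * 2 ^ i) : ZMod 2) := by
  refine (Finset.sum_subset (Finset.range_mono hM) fun i _ hi => ?_).symm
  have hi : n ≤ i := by simpa using hi
  rw [Nat.choose_eq_zero_of_lt, Nat.cast_zero]
  exact hi.trans_lt (i.lt_two_pow_self.trans_le (Nat.le_mul_of_pos_left _ hm))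

theorem allOnePattern_eq_sum_choose {k : ℕ} (hk : 1 ≤ k) {r : ℕ → ZMod 2} (hr0 : r 0 = 0)
    (hrec : ∀ n, 1 ≤ n → r n = r (n / 2) + if n % 2 ^ k = 2 ^ k - 1 then 1 else 0) (n : ℕ) :
    r n = ∑ i ∈ Finset.range n, (n.choose ((2 ^ k - 1) * 2 ^ i) : ZMod 2) := by
  have hm : 0 < 2 ^ k - 1 := Nat.sub_pos_of_lt (Nat.one_lt_two_pow (by omega))
  induction n using Nat.strong_induction_on with
  | _ n ih =>
    rcases n with _ | n
    · simpa using hr0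
    · rw [hrec _ n.succ_pos, ih _ (by omega), ← cast_choose_two_pow_sub_one, Finset.sum_range_succ',
        pow_zero, mul_one, ← sum_range_cast_choose_mul_two_pow hm (show (n + 1) / 2 ≤ n by omega)]
      congr 1
      refine Finset.sum_congr rfl fun i _ => ?_
      rw [← cast_choose_two_mul, pow_succ']
      congr 2
      ring

end PatternSequence

theorem allOnePattern_linearComplexity (k : ℕ) (hk : 1 ≤ k)
    (r : ℕ → ZMod 2) (hr0 : r 0 = 0)
    (hrec : ∀ n, 1 ≤ n → r n = r (n / 2) + if n % 2 ^ k = 2 ^ k - 1 then 1 else 0)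
    (N : ℕ) (hN : 1 ≤ N) :
    linearComplexity r N =
      if 2 ^ k ≤ N % (4 * (2 ^ k - 1)) ∧ N % (4 * (2 ^ k - 1)) ≤ 3 * (2 ^ k - 1) then
        2 * (2 ^ k - 1) * (N / (4 * (2 ^ k - 1))) + 2 ^ k
      else
        2 * (2 ^ k - 1) * ((N + 2 ^ k - 2) / (4 * (2 ^ k - 1))) := by
  obtain ⟨m, hmk⟩ : ∃ m, 2 ^ k = m + 1 := ⟨2 ^ k - 1, by have := Nat.two_pow_pos k; omega⟩
  have hm : 0 < m := by have := Nat.one_lt_two_pow (n := k) (by omega); omega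
  set φ := dilatedFunctional m ∘ₗ taylor 1 with hφdef
  have hφ (n : ℕ) : φ (X ^ n) = r n := by
    rw [hφdef, LinearMap.comp_apply, taylor_X_pow, C_1, dilatedFunctional_X_add_one_pow hm,
      allOnePattern_eq_sum_choose hk hr0 hrec, hmk, Nat.add_sub_cancel]
  let P (q : ℕ) := taylor (-1) (expand (ZMod 2) m (convergentDenom (2 * q)))
  let Q (q : ℕ) := taylor (-1) (X * expand (ZMod 2) m (convergentDenom (2 * q + 1)))
  have hP (q : ℕ) : VanishesToOrder φ (P q) (2 * m * q + m) := (vanishesToOrder_even hm q).taylor 1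
  have hQ (q : ℕ) : VanishesToOrder φ (Q q) (2 * m * (q + 1) - 1) :=
    (vanishesToOrder_odd hm q).taylor 1
  have hPdeg (q : ℕ) : (P q).natDegree = 2 * m * q := by
    rw [natDegree_taylor, natDegree_expand, (convergentDenom_monic_natDegree _).2]
    ring
  have hPmonic (q : ℕ) : (P q).Monic := by
    rw [Monic, leadingCoeff_taylor]
    exact (convergentDenom_monic_natDegree _).1.expand hm
  have hQ' (q : ℕ) := (convergentDenom_monic_natDegree (2 * q + 1)).1.expand hm
  have hQdeg (q : ℕ) : (Q q).natDegree = 2 * m * q + m + 1 := by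
    rw [natDegree_taylor, natDegree_X_mul (hQ' q).ne_zero, natDegree_expand,
      (convergentDenom_monic_natDegree _).2]
    ring
  have hQmonic (q : ℕ) : (Q q).Monic := by
    rw [Monic, leadingCoeff_taylor]
    exact monic_X.mul (hQ' q)
  have hupper (q : ℕ) (h1 : 4 * (m * q) + m + 1 ≤ N) (h2 : N ≤ 4 * (m * q) + 3 * m) :
      linearComplexity r N = 2 * m * q + m + 1 := by
    rw [← hQdeg]
    refine linearComplexity_eq_natDegree hφ (hP q) (hQmonic q) (hQ q) ?_ ?_ ?_ <;>
    · simp only [hQdeg, hPdeg, mul_add, mul_assoc]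
      omega
  have hlower (q : ℕ) (h1 : 4 * (m * q) + 1 ≤ N + m) (h2 : N ≤ 4 * (m * q) + m) :
      linearComplexity r N = 2 * m * q := by
    rcases q with _ | q
    · have h := linearComplexity_le_natDegree hφ (hPmonic 0) (hP 0) (N := N) (by rw [hPdeg]; omega)
      rw [hPdeg] at h
      omega
    · rw [← hPdeg]
      refine linearComplexity_eq_natDegree hφ (hQ q) (hPmonic (q + 1)) (hP (q + 1)) ?_ ?_ ?_ <;>
      · simp only [hQdeg, hPdeg, mul_add, mul_assoc] at *
        omega
  rw [hmk, Nat.add_sub_cancel]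
  have hdiv := Nat.div_add_mod N (4 * m)
  have hlt := Nat.mod_lt N (show 0 < 4 * m by omega)
  set q := N / (4 * m)
  set s := N % (4 * m)
  rw [mul_assoc] at hdiv
  split_ifs with h
  · rw [hupper q (by omega) (by omega), add_assoc]
  · rcases le_or_gt s m with hs | hs
    · have hd : (N + (m + 1) - 2) / (4 * m) = q := by
        rw [Nat.div_eq_iff (by omega), mul_left_comm, mul_comm q m]
        omega
      rw [hd, hlower q (by omega) (by omega)]
    · have hd : (N + (m + 1) - 2) / (4 * m) = q + 1 := by
        rw [Nat.div_eq_iff (by omega), mul_left_comm, mul_comm (q + 1) m, mul_add]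
        omega
      rw [hd, hlower (q + 1) (by rw [mul_add]; omega) (by rw [mul_add]; omega)]
end
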